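/- If 1 > p > 1/4, then there exists a positive integer r_0 = r_0(p) such that for all r ≥ r_0, lim_{n→∞} p_R(n,r,p) = 1, where p_R(n,r,p) is the probability that the fixed point of strict MBP on C_n(r) has strictly more active than passive vertices. -/

import Mathlib

open Finset


/-- Number of active neighbors of vertex `i` in the ring `C_n(r)`.
For `n > 2r+1` the `2r` offsets `±1, …, ±r` give pairwise distinct neighbors. -/
def activeNbrs (n r : ℕ) (σ : ZMod n → Bool) (i : ZMod n) : ℕ :=
  ∑ k ∈ Finset.Icc 1 r,
    ((if σ (i + (k : ZMod n)) then 1 else 0) + (if σ (i - (k : ZMod n)) then 1 else 0))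

/-- One synchronous step of strict majority bootstrap percolation on `C_n(r)`:
a passive vertex (degree `2r`) becomes active iff at least `r+1 = ⌈(2r+1)/2⌉`
of its neighbors are active; active vertices stay active. -/
def ringStep (n r : ℕ) (σ : ZMod n → Bool) : ZMod n → Bool :=
  fun i => σ i || decide (r + 1 ≤ activeNbrs n r σ i)

/-- The fixed point of strict MBP on `C_n(r)`; `n` monotone steps suffice to stabilize. -/
def ringFix (n r : ℕ) (σ : ZMod n → Bool) : ZMod n → Bool :=
  (ringStep n r)^[n] σ

/-- Probability of an event under i.i.d. Bernoulli(`p`) initial states. -/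
noncomputable def pr {V : Type} [Fintype V] [DecidableEq V] (p : ℝ) (S : Set (V → Bool)) : ℝ :=
  ∑ σ : V → Bool, S.indicator (fun τ => ∏ v, (if τ v then p else 1 - p)) σ

/-- Expectation of a random variable under i.i.d. Bernoulli(`p`) initial states. -/
noncomputable def expec {V : Type} [Fintype V] [DecidableEq V]
    (p : ℝ) (f : (V → Bool) → ℝ) : ℝ :=
  ∑ σ : V → Bool, f σ * ∏ v, (if σ v then p else 1 - p)

/-- `E_p[X_0(n,r)]`: probability that vertex `0` is active at the fixed point. -/
noncomputable def Ex (r : ℕ) (p : ℝ) (n : ℕ) : ℝ :=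
  if h : n = 0 then 0 else
    haveI : NeZero n := ⟨h⟩
    pr p {σ : ZMod n → Bool | ringFix n r σ 0 = true}

/-- `p_R(n,r,p)`: probability that strictly more than half of the `n` vertices are
active at the fixed point of strict MBP on `C_n(r)`. -/
noncomputable def pR (r : ℕ) (p : ℝ) (n : ℕ) : ℝ :=
  if h : n = 0 then 0 else
    haveI : NeZero n := ⟨h⟩
    pr p {σ : ZMod n → Bool |
      n < 2 * (Finset.univ.filter (fun i : ZMod n => ringFix n r σ i = true)).card}


section ProbLemmas

variable {U V ι κ : Type} [Fintype U] [DecidableEq U] [Fintype V] [DecidableEq V]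
  [Fintype ι] [DecidableEq ι] [Fintype κ] [DecidableEq κ]

lemma sum_prod_indep (h : V → Bool → ℝ) :
    ∑ σ : V → Bool, ∏ v, h v (σ v) = ∏ v, (h v true + h v false) := by
  have := Fintype.prod_sum (fun v b => h v b)
  rw [← this]
  simp

lemma weight_sum (p : ℝ) : ∑ σ : V → Bool, ∏ v, (if σ v then p else 1 - p) = 1 := by
  have := sum_prod_indep (V := V) (fun _ b => if b then p else 1 - p)
  rw [this]; simp

lemma expec_equiv (p : ℝ) (e : U ≃ V) (F : (U → Bool) → ℝ) :
    expec p (fun σ : V → Bool => F (σ ∘ e)) = expec p F := by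
  unfold expec
  refine Fintype.sum_equiv (Equiv.arrowCongr e.symm (Equiv.refl Bool)) _ _ ?_
  intro σ
  have h1 : (Equiv.arrowCongr e.symm (Equiv.refl Bool)) σ = σ ∘ e := by
    ext x; simp
  rw [h1]
  congr 1
  exact (Equiv.prod_comp e (fun v => if σ v then p else 1 - p)).symm

lemma expec_sum_inl (p : ℝ) (F : (U → Bool) → ℝ) :
    expec p (fun σ : U ⊕ V → Bool => F (σ ∘ Sum.inl)) = expec p F := by
  unfold expec
  rw [Fintype.sum_equiv (Equiv.sumArrowEquivProdArrow U V Bool)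
    _ (fun x : (U → Bool) × (V → Bool) =>
      (F x.1 * ∏ v, (if x.1 v then p else 1 - p)) * ∏ v, (if x.2 v then p else 1 - p))]
  · rw [Fintype.sum_prod_type]
    refine Finset.sum_congr rfl fun x _ => ?_
    dsimp only
    have h := Finset.mul_sum Finset.univ
      (fun y : V → Bool => ∏ v, (if y v then p else 1 - p)) (F x * ∏ v, (if x v then p else 1 - p))
    rw [weight_sum, mul_one] at h
    exact h.symm
  · intro σ
    rw [Fintype.prod_sum_type, mul_assoc]
    rfl

lemma expec_embed (p : ℝ) (e : U → V) (he : Function.Injective e) (F : (U → Bool) → ℝ) :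
    expec p (fun σ : V → Bool => F (σ ∘ e)) = expec p F := by
  classical
  let E : U ⊕ ((Set.range e)ᶜ : Set V) ≃ V :=
    (Equiv.sumCongr (Equiv.ofInjective e he) (Equiv.refl _)).trans (Equiv.Set.sumCompl (Set.range e))
  have h1 := expec_equiv p E (fun τ => F (τ ∘ Sum.inl))
  have h2 := expec_sum_inl (V := ((Set.range e)ᶜ : Set V)) p F
  rw [← h2, ← h1]
  congr 1

lemma expec_block (p : ℝ) (g : (κ → Bool) → ℝ) :
    expec p (fun σ : ι × κ → Bool => ∏ i, g (fun k => σ (i, k))) =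
      (expec p g) ^ (Fintype.card ι) := by
  unfold expec
  have h := Fintype.prod_sum (fun (_ : ι) (τ : κ → Bool) => g τ * ∏ v, (if τ v then p else 1 - p))
  simp only [Finset.prod_const, Finset.card_univ] at h
  rw [h]
  refine Fintype.sum_equiv (Equiv.curry ι κ Bool) _ _ ?_
  intro σ
  rw [Finset.prod_mul_distrib, Fintype.prod_prod_type]
  rfl

lemma expec_block_embed (p : ℝ) (e : ι × κ → V) (he : Function.Injective e)
    (g : (κ → Bool) → ℝ) :
    expec p (fun σ : V → Bool => ∏ i, g (fun k => σ (e (i, k)))) =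
      (expec p g) ^ (Fintype.card ι) := by
  rw [← expec_block, ← expec_embed p e he]
  rfl

lemma expec_mono {p : ℝ} (h0 : 0 ≤ p) (h1 : p ≤ 1) {F G : (V → Bool) → ℝ} (h : ∀ σ, F σ ≤ G σ) :
    expec p F ≤ expec p G := by
  unfold expec
  refine Finset.sum_le_sum fun σ _ => mul_le_mul_of_nonneg_right (h σ) ?_
  refine Finset.prod_nonneg fun v _ => ?_
  split_ifs <;> linarith

lemma expec_add (p : ℝ) (F G : (V → Bool) → ℝ) :
    expec p (fun σ => F σ + G σ) = expec p F + expec p G := by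
  simp [expec, add_mul, Finset.sum_add_distrib]

lemma expec_const_mul (p c : ℝ) (F : (V → Bool) → ℝ) :
    expec p (fun σ => c * F σ) = c * expec p F := by
  simp [expec, mul_assoc, Finset.mul_sum]

lemma expec_one (p : ℝ) : expec p (fun _ : V → Bool => 1) = 1 := by
  simp [expec, weight_sum]

lemma expec_sum {α : Type} (s : Finset α) (p : ℝ) (F : α → (V → Bool) → ℝ) :
    expec p (fun σ => ∑ a ∈ s, F a σ) = ∑ a ∈ s, expec p (F a) := by
  simp only [expec, Finset.sum_mul]
  rw [Finset.sum_comm]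

lemma pr_eq (p : ℝ) (S : Set (V → Bool)) : pr p S = expec p (S.indicator 1) := by
  classical
  unfold pr expec
  refine Finset.sum_congr rfl fun σ _ => ?_
  by_cases h : σ ∈ S <;> simp [h]

lemma pr_compl (p : ℝ) (S : Set (V → Bool)) : pr p Sᶜ = 1 - pr p S := by
  have h : expec p (fun σ : V → Bool => (Sᶜ).indicator 1 σ + S.indicator 1 σ) = 1 := by
    rw [← expec_one (V := V) p]
    congr 1
    funext σ
    by_cases h : σ ∈ S <;> simp [h]
  rw [expec_add] at h
  rw [pr_eq, pr_eq]
  linarith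

lemma pr_mono {p : ℝ} (h0 : 0 ≤ p) (h1 : p ≤ 1) {S T : Set (V → Bool)} (h : S ⊆ T) :
    pr p S ≤ pr p T := by
  rw [pr_eq, pr_eq]
  refine expec_mono h0 h1 fun σ => ?_
  exact Set.indicator_le_indicator_of_subset h (fun _ => by simp) σ

lemma pr_nonneg {p : ℝ} (h0 : 0 ≤ p) (h1 : p ≤ 1) (S : Set (V → Bool)) : 0 ≤ pr p S := by
  have := pr_mono h0 h1 (Set.empty_subset S)
  simpa [pr] using this

lemma pr_le_one {p : ℝ} (h0 : 0 ≤ p) (h1 : p ≤ 1) (S : Set (V → Bool)) : pr p S ≤ 1 := by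
  have := pr_nonneg h0 h1 Sᶜ
  rw [pr_compl] at this
  linarith

lemma pr_union_le {p : ℝ} (h0 : 0 ≤ p) (h1 : p ≤ 1) (S T : Set (V → Bool)) :
    pr p (S ∪ T) ≤ pr p S + pr p T := by
  rw [pr_eq, pr_eq, pr_eq, ← expec_add]
  refine expec_mono h0 h1 fun σ => ?_
  by_cases hS : σ ∈ S <;> by_cases hT : σ ∈ T <;> simp [hS, hT]

lemma pr_biUnion_le {α : Type} {p : ℝ} (h0 : 0 ≤ p) (h1 : p ≤ 1) (s : Finset α)
    (S : α → Set (V → Bool)) :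
    pr p {σ | ∃ a ∈ s, σ ∈ S a} ≤ ∑ a ∈ s, pr p (S a) := by
  classical
  simp only [pr_eq]
  rw [← expec_sum]
  refine expec_mono h0 h1 fun σ => ?_
  have hn : ∀ a ∈ s, (0:ℝ) ≤ (S a).indicator 1 σ :=
    fun a _ => Set.indicator_nonneg (fun _ _ => by simp) _
  by_cases h : ∃ a ∈ s, σ ∈ S a
  · obtain ⟨a, ha, hσ⟩ := h
    rw [Set.indicator_of_mem (by exact ⟨a, ha, hσ⟩)]
    have := Finset.single_le_sum hn ha
    rw [Set.indicator_of_mem hσ] at this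
    simpa using this
  · rw [Set.indicator_of_notMem (by exact h)]
    exact Finset.sum_nonneg hn

lemma pr_block_embed (p : ℝ) (e : ι × κ → V) (he : Function.Injective e)
    (S : Set (κ → Bool)) :
    pr p {σ : V → Bool | ∀ i, (fun k => σ (e (i, k))) ∈ S} = (pr p S) ^ (Fintype.card ι) := by
  classical
  rw [pr_eq, pr_eq, ← expec_block_embed p e he]
  congr 1
  funext σ
  simp only [Set.indicator_apply, Set.mem_ofPred_eq, Pi.one_apply]
  rw [Finset.prod_ite_zero]
  simp

end ProbLemmas

/-- number of active sites in `[a,b)`. -/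
noncomputable def cnt (f : ℤ → Bool) (a b : ℤ) : ℕ := ((Finset.Ico a b).filter (fun x => f x = true)).card

lemma cnt_mono {f : ℤ → Bool} {a b a' b' : ℤ} (h1 : a' ≤ a) (h2 : b ≤ b') :
    cnt f a b ≤ cnt f a' b' := by
  unfold cnt
  apply Finset.card_le_card
  apply Finset.filter_subset_filter
  exact Finset.Ico_subset_Ico h1 h2

lemma cnt_add (f : ℤ → Bool) {a b c : ℤ} (h1 : a ≤ b) (h2 : b ≤ c) :
    cnt f a c = cnt f a b + cnt f b c := by
  unfold cnt
  rw [← Finset.card_union_of_disjoint]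
  · rw [← Finset.filter_union, Finset.Ico_union_Ico_eq_Ico h1 h2]
  · rw [Finset.disjoint_left]
    intro x hx hy
    simp only [Finset.mem_filter, Finset.mem_Ico] at hx hy
    omega

lemma cnt_full {f : ℤ → Bool} {a b : ℤ} (h : ∀ x, a ≤ x → x < b → f x = true) :
    cnt f a b = (b - a).toNat := by
  unfold cnt
  rw [Finset.filter_true_of_mem, Int.card_Ico]
  intro x hx
  rw [Finset.mem_Ico] at hx
  exact h x hx.1 hx.2

lemma cnt_pos {f : ℤ → Bool} {a b x : ℤ} (h1 : a ≤ x) (h2 : x < b) (h : f x = true) :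
    1 ≤ cnt f a b := by
  unfold cnt
  apply Finset.card_pos.mpr
  exact ⟨x, by simp [h1, h2, h]⟩

lemma cells_cnt {f : ℤ → Bool} {s : ℤ} {j K : ℕ}
    (hc : ∀ i : ℕ, i < K → j + 1 ≤ cnt f (s + 2 * j * i) (s + 2 * j * i + 2 * j)) (i0 d : ℕ)
    (h : i0 + d ≤ K) :
    (j + 1) * d ≤ cnt f (s + 2 * j * i0) (s + 2 * j * (i0 + d : ℕ)) := by
  induction d with
  | zero => simp
  | succ d ih =>
    have h1 := ih (by omega)
    have h2 := hc (i0 + d) (by omega)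
    rw [cnt_add f (b := s + 2 * j * (i0 + d : ℕ))]
    · have : s + 2 * (j:ℤ) * (i0 + (d + 1) : ℕ) = s + 2 * j * (i0 + d : ℕ) + 2 * j := by
        push_cast; ring
      rw [this]
      linarith
    · push_cast; nlinarith [mul_nonneg (Int.natCast_nonneg j) (Int.natCast_nonneg d)]
    · push_cast; nlinarith [mul_nonneg (Int.natCast_nonneg j) (Int.natCast_nonneg d)]

lemma interval_cnt {f : ℤ → Bool} {s : ℤ} {j K : ℕ} (hj : 0 < j)
    (hc : ∀ i : ℕ, i < K → j + 1 ≤ cnt f (s + 2 * j * i) (s + 2 * j * i + 2 * j))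
    {a b : ℤ} (ha : s ≤ a) (hb : b ≤ s + 2 * j * K) :
    ((j:ℤ) + 1) * (b - a - 4 * j) ≤ 2 * j * cnt f a b := by
  by_cases hab : b - a - 4 * j ≤ 0
  · have : ((j:ℤ) + 1) * (b - a - 4 * j) ≤ 0 := mul_nonpos_of_nonneg_of_nonpos (by positivity) hab
    have h2 : (0:ℤ) ≤ 2 * j * cnt f a b := by positivity
    linarith
  push Not at hab
  obtain ⟨a', rfl⟩ : ∃ a' : ℕ, a = s + a' := ⟨(a - s).toNat, by omega⟩
  obtain ⟨b', rfl⟩ : ∃ b' : ℕ, b = s + b' := ⟨(b - s).toNat, by omega⟩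
  set m := 2 * j with hm
  have hmpos : 0 < m := by omega
  have hbK : b' ≤ m * K := by
    have : (b':ℤ) ≤ ((m * K : ℕ) : ℤ) := by rw [hm]; push_cast; linarith
    exact_mod_cast this
  have ea := Nat.div_add_mod a' m
  have eb := Nat.div_add_mod b' m
  have la := Nat.mod_lt a' hmpos
  have lb := Nat.mod_lt b' hmpos
  set qa := a' / m
  set qb := b' / m
  have hqb : qb ≤ K := by
    have : b' / m ≤ (m * K) / m := Nat.div_le_div_right hbK
    rwa [Nat.mul_div_cancel_left _ hmpos] at this
  have hlt : qa + 1 ≤ qb := by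
    by_contra hcon
    have : m * qb ≤ m * qa := Nat.mul_le_mul_left m (by omega)
    omega
  obtain ⟨d, hd⟩ := Nat.exists_eq_add_of_le hlt
  have h1 := cells_cnt hc (qa + 1) d (by omega)
  have h2 : cnt f (s + 2 * j * (qa + 1 : ℕ)) (s + 2 * j * (qa + 1 + d : ℕ)) ≤
      cnt f (s + a') (s + b') := by
    apply cnt_mono
    · have : (a':ℤ) ≤ ((m * (qa + 1) : ℕ) : ℤ) := by
        have : a' ≤ m * (qa + 1) := by rw [mul_add]; omega
        exact_mod_cast this
      rw [hm] at this; push_cast at this ⊢; linarith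
    · have : ((m * (qa + 1 + d) : ℕ) : ℤ) ≤ b' := by
        have : m * (qa + 1 + d) ≤ b' := by rw [← hd]; omega
        exact_mod_cast this
      rw [hm] at this; push_cast at this ⊢; linarith
  have h3 : ((j:ℤ) + 1) * d ≤ cnt f (s + a') (s + b') := by exact_mod_cast h1.trans h2
  have h4 : (b':ℤ) - a' - 2 * m ≤ m * d := by
    have : b' ≤ a' + 2 * m + m * d := by
      have : m * qb = m * qa + m + m * d := by rw [hd]; ring
      omega
    have : (b':ℤ) ≤ a' + 2 * m + m * d := by exact_mod_cast this
    linarith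
  have hm' : (m:ℤ) = 2 * j := by rw [hm]; push_cast; ring
  rw [hm'] at h4
  have hj' : (0:ℤ) ≤ j := by positivity
  nlinarith [mul_le_mul_of_nonneg_left h3 (by linarith : (0:ℤ) ≤ 2 * j),
    mul_le_mul_of_nonneg_left h4 (by linarith : (0:ℤ) ≤ (j:ℤ) + 1)]

/-- closedness under strict majority -/
def Closed (r : ℕ) (f : ℤ → Bool) : Prop :=
  ∀ k : ℤ, r + 1 ≤ cnt f (k - r) k + cnt f (k + 1) (k + r + 1) → f k = true

lemma seed_grow {f : ℤ → Bool} {r : ℕ} (hf : Closed r f) {s : ℤ} {j K : ℕ} (hj : 0 < j)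
    (hc : ∀ i : ℕ, i < K → j + 1 ≤ cnt f (s + 2 * j * i) (s + 2 * j * i + 2 * j))
    (hK1 : r < j * K) (hr : 100 * j ^ 2 ≤ r) (b : ℕ) (hb : 2 * b ≤ r + 2) :
    ∀ x : ℤ, s + j * K - b ≤ x → x < s + j * K + b → f x = true := by
  induction b with
  | zero => intro x h1 h2; simp at h1 h2; omega
  | succ b ih =>
    have ih := ih (by omega)
    obtain ⟨R, hR⟩ : ∃ R : ℤ, R = j * K := ⟨_, rfl⟩
    have hRr : (r:ℤ) < R := by rw [hR]; exact_mod_cast hK1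
    have hr' : 100 * (j:ℤ) ^ 2 ≤ r := by exact_mod_cast hr
    have hj' : (1:ℤ) ≤ j := by exact_mod_cast hj
    have hb' : 2 * ((b:ℤ) + 1) ≤ r + 2 := by exact_mod_cast hb
    have hb0 : (0:ℤ) ≤ b := by positivity
    rw [← hR] at ih ⊢
    have hjb : 0 ≤ (j:ℤ) * b := by positivity
    have hjj : (j:ℤ) ≤ j ^ 2 := by nlinarith
    have key : ∀ u v w : ℕ, ((j:ℤ)+1) * ((r - 2 * b) - 4 * j) ≤ 2 * j * u → 2 * b ≤ v →
        ((j:ℤ)+1) * ((r - b - 1) - 4 * j) ≤ 2 * j * w → r + 1 ≤ u + v + w := by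
      intro u v w h1 h2 h3
      have h2' : 2 * (b:ℤ) ≤ v := by exact_mod_cast h2
      have h4 : 2 * (j:ℤ) * (r + 1) ≤ 2 * j * (u + v + w) := by
        nlinarith [mul_le_mul_of_nonneg_left h2' (by linarith : (0:ℤ) ≤ 2 * j)]
      have := le_of_mul_le_mul_left h4 (by linarith)
      exact_mod_cast this
    have e2 : s + 2 * (j:ℤ) * K = s + 2 * R := by rw [hR]; ring
    have hfull : cnt f (s + R - b) (s + R + b) = 2 * b := by
      rw [cnt_full ih]; omega
    have hright : f (s + R + b) = true := by
      apply hf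
      rw [cnt_add f (b := s + R - b) (by linarith) (by linarith), hfull]
      apply key
      · have := interval_cnt hj hc (a := s + R + b - r) (b := s + R - b) (by linarith) (by linarith)
        refine le_trans (le_of_eq ?_) this
        ring
      · exact le_rfl
      · have := interval_cnt hj hc (a := s + R + b + 1) (b := s + R + r) (by linarith) (by linarith)
        have h2 : cnt f (s + R + b + 1) (s + R + r) ≤ cnt f (s + R + b + 1) (s + R + b + r + 1) :=
          cnt_mono le_rfl (by linarith)
        have h2' : (cnt f (s + R + b + 1) (s + R + r) : ℤ) ≤
          cnt f (s + R + b + 1) (s + R + b + r + 1) := by exact_mod_cast h2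
        have h3 := mul_le_mul_of_nonneg_left h2' (by linarith : (0:ℤ) ≤ 2 * j)
        refine le_trans (le_of_eq ?_) (this.trans h3)
        ring
    have hleft : f (s + R - b - 1) = true := by
      apply hf
      have e3 : s + R - b - 1 + 1 = s + R - b := by ring
      rw [e3, cnt_add f (a := s + R - b) (b := s + R + b) (by linarith) (by linarith), hfull]
      have := key (cnt f (s + R + b) (s + R - b - 1 + r + 1)) (2 * b)
        (cnt f (s + R - b - 1 - r) (s + R - b - 1)) ?_ le_rfl ?_
      · omega
      · have := interval_cnt hj hc (a := s + R + b) (b := s + R - b - 1 + r + 1)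
          (by linarith) (by linarith)
        refine le_trans (le_of_eq ?_) this
        ring
      · have := interval_cnt hj hc (a := s + R - r) (b := s + R - b - 1) (by linarith) (by linarith)
        have h2 : cnt f (s + R - r) (s + R - b - 1) ≤ cnt f (s + R - b - 1 - r) (s + R - b - 1) :=
          cnt_mono (by linarith) le_rfl
        have h2' : (cnt f (s + R - r) (s + R - b - 1) : ℤ) ≤
          cnt f (s + R - b - 1 - r) (s + R - b - 1) := by exact_mod_cast h2
        have h3 := mul_le_mul_of_nonneg_left h2' (by linarith : (0:ℤ) ≤ 2 * j)
        refine le_trans (le_of_eq ?_) (this.trans h3)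
        ring
    intro x h1 h2
    push_cast at h1 h2
    by_cases c1 : x = s + R + b
    · rw [c1]; exact hright
    by_cases c2 : x = s + R - b - 1
    · rw [c2]; exact hleft
    exact ih x (by omega) (by omega)

lemma run_grow {f : ℤ → Bool} {r : ℕ} (hf : Closed r f) {lo hi x y : ℤ}
    (hrun : ∀ v, lo ≤ v → v + r < hi → ∃ w, v ≤ w ∧ w ≤ v + r ∧ f w = true)
    (hx : lo ≤ x) (hy : y ≤ hi) (hxy : x + r ≤ y) (hfull : ∀ v, x ≤ v → v < y → f v = true) :
    ∀ v, lo + r ≤ v → v < hi - r → f v = true := by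
  have right : ∀ d : ℕ, ∀ v, x ≤ v → v < y + d → v < hi - r → f v = true := by
    intro d
    induction d with
    | zero => intro v h1 h2 _; exact hfull v h1 (by simpa using h2)
    | succ d ih =>
      intro v h1 h2 h3
      by_cases c : v < y + d
      · exact ih v h1 c h3
      have hv : y + d = v := by push_cast at h2; omega
      obtain ⟨w, hw1, hw2, hw⟩ := hrun v (by linarith) (by linarith)
      by_cases cw : w = v
      · rw [← cw]; exact hw
      apply hf
      have e1 : cnt f (v - r) v = r := by
        rw [cnt_full]
        · omega
        · intro z hz1 hz2
          exact ih z (by omega) (by omega) (by omega)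
      have e2 : 1 ≤ cnt f (v + 1) (v + r + 1) := cnt_pos (x := w) (by omega) (by omega) hw
      omega
  have left : ∀ d : ℕ, ∀ v, v < y → x - d ≤ v → lo + r ≤ v → f v = true := by
    intro d
    induction d with
    | zero => intro v h1 h2 _; exact hfull v (by simpa using h2) h1
    | succ d ih =>
      intro v h1 h2 h3
      by_cases c : x - d ≤ v
      · exact ih v h1 c h3
      have hv : v = x - d - 1 := by push_cast at h2; omega
      obtain ⟨w, hw1, hw2, hw⟩ := hrun (v - r) (by linarith) (by linarith)
      by_cases cw : w = v
      · rw [← cw]; exact hw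
      apply hf
      have e1 : cnt f (v + 1) (v + r + 1) = r := by
        rw [cnt_full]
        · omega
        · intro z hz1 hz2
          exact ih z (by omega) (by omega) (by omega)
      have e2 : 1 ≤ cnt f (v - r) v := cnt_pos (x := w) (by omega) (by omega) hw
      omega
  intro v h1 h2
  by_cases c : x ≤ v
  · exact right (v - y + 1).toNat v c (by omega) h2
  · exact left (x - v).toNat v (by omega) (by omega) h1

lemma block_full {f : ℤ → Bool} {r : ℕ} (hf : Closed r f) {lo hi s : ℤ} {j K : ℕ} (hj : 0 < j)
    (hrun : ∀ v, lo ≤ v → v + r < hi → ∃ w, v ≤ w ∧ w ≤ v + r ∧ f w = true)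
    (hs : lo ≤ s) (hs2 : s + 2 * j * K ≤ hi)
    (hc : ∀ i : ℕ, i < K → j + 1 ≤ cnt f (s + 2 * j * i) (s + 2 * j * i + 2 * j))
    (hK1 : r < j * K) (hr : 100 * j ^ 2 ≤ r) :
    ∀ v, lo + r ≤ v → v < hi - r → f v = true := by
  have hK : (r:ℤ) < j * K := by exact_mod_cast hK1
  have hb : ((r / 2 + 1 : ℕ) : ℤ) ≤ r + 1 := by push_cast; omega
  have hb2 : (r:ℤ) ≤ 2 * ((r / 2 + 1 : ℕ) : ℤ) := by push_cast; omega
  exact run_grow hf hrun (x := s + j * K - (r / 2 + 1 : ℕ)) (y := s + j * K + (r / 2 + 1 : ℕ))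
    (by linarith) (by linarith) (by linarith)
    (seed_grow hf hj hc hK1 hr (r / 2 + 1) (by omega))

lemma ringStep_card (n r : ℕ) [NeZero n] (σ : ZMod n → Bool) (k : ℕ) :
    ringStep n r ((ringStep n r)^[k] σ) = (ringStep n r)^[k] σ ∨
      k ≤ (Finset.univ.filter (fun i => (ringStep n r)^[k] σ i = true)).card := by
  induction k with
  | zero => right; simp
  | succ k ih =>
    rw [Function.iterate_succ_apply']
    set τ := (ringStep n r)^[k] σ
    rcases ih with h | h
    · left; rw [h, h]
    · by_cases hfix : ringStep n r τ = τ
      · left; rw [hfix, hfix]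
      · right
        refine lt_of_le_of_lt h (Finset.card_lt_card ?_)
        refine ⟨?_, ?_⟩
        · intro i hi
          simp only [Finset.mem_filter, Finset.mem_univ, true_and] at hi ⊢
          simp [ringStep, hi]
        · intro hsub
          apply hfix
          funext i
          by_cases hi : ringStep n r τ i = true
          · have := hsub (show i ∈ _ by simpa using hi)
            simp only [Finset.mem_filter, Finset.mem_univ, true_and] at this
            rw [hi, this]
          · have h2 : ¬ τ i = true := fun h => hi (by simp [ringStep, h])
            simp only [Bool.not_eq_true] at hi h2
            rw [hi, h2]

lemma ringFix_fixed (n r : ℕ) [NeZero n] (σ : ZMod n → Bool) :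
    ringStep n r (ringFix n r σ) = ringFix n r σ := by
  rcases ringStep_card n r σ n with h | h
  · exact h
  · have h2 : (Finset.univ.filter (fun i => (ringStep n r)^[n] σ i = true)) = Finset.univ := by
      apply Finset.eq_univ_of_card
      refine le_antisymm (Finset.card_le_univ _) ?_
      rwa [ZMod.card]
    have h3 : ∀ i, ringFix n r σ i = true := by
      intro i
      have : i ∈ Finset.univ.filter (fun i => (ringStep n r)^[n] σ i = true) := by
        rw [h2]; simp
      exact (Finset.mem_filter.mp this).2
    funext i
    simp [ringStep, h3]

lemma le_iter (n r : ℕ) (σ : ZMod n → Bool) (k : ℕ) (i : ZMod n) (h : σ i = true) :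
    (ringStep n r)^[k] σ i = true := by
  induction k with
  | zero => exact h
  | succ k ih =>
    rw [Function.iterate_succ_apply']
    simp [ringStep, ih]

lemma ringFix_closed (n r : ℕ) [NeZero n] (σ : ZMod n → Bool) :
    Closed r (fun k : ℤ => ringFix n r σ (k : ZMod n)) := by
  intro k hk
  simp only
  rw [← ringFix_fixed]
  simp only [ringStep, Bool.or_eq_true, decide_eq_true_eq]
  right
  refine hk.trans (le_of_eq ?_)
  unfold activeNbrs cnt
  rw [Finset.sum_add_distrib, add_comm, Finset.card_filter, Finset.card_filter]
  congr 1
  · symm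
    refine Finset.sum_bij (fun (d : ℕ) _ => k + (d:ℤ)) ?_ ?_ ?_ ?_
    · intro d hd; simp only [Finset.mem_Icc, Finset.mem_Ico] at hd ⊢; omega
    · intro a _ b _ h; simpa using h
    · intro b hb
      simp only [Finset.mem_Ico] at hb
      exact ⟨(b - k).toNat, by simp only [Finset.mem_Icc]; omega, by omega⟩
    · intro d _; simp
  · symm
    refine Finset.sum_bij (fun (d : ℕ) _ => k - (d:ℤ)) ?_ ?_ ?_ ?_
    · intro d hd; simp only [Finset.mem_Icc, Finset.mem_Ico] at hd ⊢; omega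
    · intro a _ b _ h; simpa using h
    · intro b hb
      simp only [Finset.mem_Ico] at hb
      exact ⟨(k - b).toNat, by simp only [Finset.mem_Icc]; omega, by omega⟩
    · intro d _; simp

/-- a cell of length `2j` with more than half active -/
def cellSet (j : ℕ) : Set (Fin (2 * j) → Bool) :=
  {τ | j + 1 ≤ (Finset.univ.filter (fun y => τ y = true)).card}

lemma cell_pr {p : ℝ} (h0 : 0 ≤ p) (h1 : p ≤ 1) (j : ℕ) (_hj : 0 < j) :
    ((2 * j).choose (j + 1) : ℝ) * (p ^ (j + 1) * (1 - p) ^ (j - 1)) ≤ pr p (cellSet j) := by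
  classical
  have hnn : ∀ τ : Fin (2 * j) → Bool, 0 ≤ ∏ v, (if τ v then p else 1 - p) := fun τ =>
    Finset.prod_nonneg fun v _ => by split_ifs <;> linarith
  let φ : Finset (Fin (2 * j)) → (Fin (2 * j) → Bool) := fun s y => decide (y ∈ s)
  have hφ : Function.Injective φ := by
    intro s t hst
    ext y
    have := congrFun hst y
    simpa [φ] using this
  have hsub : ((Finset.powersetCard (j + 1) (Finset.univ : Finset (Fin (2 * j)))).image φ) ⊆
      Finset.univ := Finset.subset_univ _
  unfold pr
  refine le_trans ?_ (Finset.sum_le_sum_of_subset_of_nonneg hsub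
    (fun σ _ _ => Set.indicator_nonneg (fun τ _ => hnn τ) σ))
  rw [Finset.sum_image (fun a _ b _ h => hφ h)]
  rw [Finset.sum_congr rfl (g := fun _ => p ^ (j + 1) * (1 - p) ^ (j - 1))]
  · simp
  · intro s hs
    rw [Finset.mem_powersetCard] at hs
    rw [Set.indicator_of_mem]
    · simp only [φ, decide_eq_true_eq]
      rw [Finset.prod_ite, Finset.prod_const, Finset.prod_const]
      have e1 : (Finset.univ.filter (fun y => y ∈ s)) = s := by ext; simp
      have e2 : (Finset.univ.filter (fun y => y ∉ s)) = sᶜ := by ext; simp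
      rw [e1, e2, Finset.card_compl, hs.2, Fintype.card_fin]
      congr 2
      omega
    · simp only [cellSet, φ, Set.mem_ofPred_eq, decide_eq_true_eq]
      have e1 : (Finset.univ.filter (fun y => y ∈ s)) = s := by ext; simp
      rw [e1, hs.2]

lemma choose_lower (j : ℕ) (hj : 0 < j) : (4:ℝ) ^ j ≤ 4 * j * ((2 * j).choose (j + 1) : ℝ) := by
  have h1 := Nat.four_pow_le_two_mul_self_mul_centralBinom j hj
  have h2 : (2 * j).choose (j + 1) * (j + 1) = (2 * j).choose j * j := by
    have := Nat.choose_succ_right_eq (2 * j) j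
    rwa [show 2 * j - j = j by omega] at this
  rw [Nat.centralBinom] at h1
  have h3 : (2 * j).choose j ≤ 2 * (2 * j).choose (j + 1) := by
    have : (2 * j).choose j * j ≤ (2 * (2 * j).choose (j + 1)) * j := by nlinarith
    exact Nat.le_of_mul_le_mul_right this hj
  have h4 : 4 ^ j ≤ 4 * j * (2 * j).choose (j + 1) := by nlinarith
  exact_mod_cast h4

lemma exists_j {p : ℝ} (hp : 1 / 4 < p) (hp1 : p < 1) :
    ∃ j : ℕ, 0 < j ∧ (1 - p) ^ j < pr p (cellSet j) := by
  have h4 : 1 < 4 * p := by linarith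
  have hlim := tendsto_self_mul_const_pow_of_lt_one (r := (4 * p)⁻¹) (by positivity)
    (inv_lt_one_of_one_lt₀ h4)
  have hε : 0 < p / 4 := by linarith
  obtain ⟨j, hj, hj0⟩ := ((hlim.eventually (gt_mem_nhds hε)).and (Filter.eventually_gt_atTop 0)).exists
  refine ⟨j, hj0, lt_of_lt_of_le ?_ (cell_pr (by linarith) hp1.le j hj0)⟩
  rw [inv_pow, ← div_eq_mul_inv, div_lt_iff₀ (by positivity)] at hj
  have hc := choose_lower j hj0
  set c : ℝ := ((2 * j).choose (j + 1) : ℝ)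
  have hj' : (0:ℝ) < j := by exact_mod_cast hj0
  -- 4 j < p * (4p)^j <= p * p^j * 4 j c
  have h1 : 4 * (j:ℝ) * 1 < 4 * j * (p ^ (j + 1) * c) := by
    have hpp : 0 ≤ p ^ (j + 1) := by positivity
    have := mul_le_mul_of_nonneg_left hc hpp
    have e : p / 4 * (4 * p) ^ j = p ^ (j + 1) * 4 ^ j / 4 := by
      rw [mul_pow, pow_succ]; ring
    rw [e] at hj
    linarith
  have h2 : 1 < p ^ (j + 1) * c := lt_of_mul_lt_mul_left h1 (by positivity)
  have hq : 0 < (1 - p) ^ j := pow_pos (by linarith) _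
  have h3 : (1 - p) ^ j ≤ (1 - p) ^ (j - 1) :=
    pow_le_pow_of_le_one (by linarith) (by linarith) (by omega)
  have hcp : 0 < p ^ (j + 1) * c := by linarith
  calc (1 - p) ^ j < (p ^ (j + 1) * c) * (1 - p) ^ j := by nlinarith
    _ ≤ (p ^ (j + 1) * c) * (1 - p) ^ (j - 1) := by gcongr
    _ = _ := by ring

lemma exists_K {a q b C : ℝ} (ha : 0 ≤ a) (haq : a < q) (hb : 0 < b) (hC : 0 < C) :
    ∃ K0 : ℕ, ∀ K : ℕ, K0 ≤ K → C * K * a ^ K ≤ b * q ^ K := by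
  have hq : 0 < q := by linarith
  have hlim := tendsto_self_mul_const_pow_of_lt_one (r := a / q) (by positivity)
    ((div_lt_one hq).mpr haq)
  have hε : 0 < b / C := by positivity
  obtain ⟨K0, hK⟩ := Filter.eventually_atTop.mp (hlim.eventually (gt_mem_nhds hε))
  refine ⟨K0, fun K hKK => ?_⟩
  have := hK K hKK
  rw [div_pow, ← mul_div_assoc, div_lt_div_iff₀ (by positivity) hC] at this
  linarith

/-- no long passive run -/
def noRun (L r : ℕ) : Set (Fin L → Bool) :=
  {τ | ∀ v : ℕ, v + r < L → ∃ x : Fin L, v ≤ x ∧ (x : ℕ) ≤ v + r ∧ τ x = true}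

def seed1 (K j : ℕ) : Set (Fin (K * (2 * j)) → Bool) :=
  {τ | ∀ i : Fin K, (fun y => τ (finProdFinEquiv (i, y))) ∈ cellSet j}

def hasSeed (T K j : ℕ) : Set (Fin (T * (K * (2 * j))) → Bool) :=
  {τ | ∃ t : Fin T, (fun x => τ (finProdFinEquiv (t, x))) ∈ seed1 K j}

lemma seed_pr (p : ℝ) (T K j : ℕ) :
    pr p (hasSeed T K j)ᶜ = (1 - (pr p (cellSet j)) ^ K) ^ T := by
  have h1 : (hasSeed T K j)ᶜ =
      {τ | ∀ t : Fin T, (fun x => τ (finProdFinEquiv (t, x))) ∈ (seed1 K j)ᶜ} := by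
    ext τ; simp [hasSeed]
  have h2 : pr p (seed1 K j) = (pr p (cellSet j)) ^ K := by
    have := pr_block_embed p (ι := Fin K) (κ := Fin (2 * j)) finProdFinEquiv
      finProdFinEquiv.injective (cellSet j)
    rw [Fintype.card_fin] at this
    exact this
  rw [h1, pr_block_embed p (ι := Fin T) (fun x => finProdFinEquiv x) finProdFinEquiv.injective,
    pr_compl, h2, Fintype.card_fin]

lemma run_pr {p : ℝ} (h0 : 0 ≤ p) (h1 : p ≤ 1) (L r : ℕ) :
    pr p (noRun L r)ᶜ ≤ L * (1 - p) ^ r := by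
  let S : ℕ → Set (Fin L → Bool) := fun v =>
    {τ | v + r < L ∧ ∀ x : Fin L, v ≤ x → (x : ℕ) ≤ v + r → τ x = false}
  have hsub : (noRun L r)ᶜ ⊆ {τ | ∃ v ∈ Finset.range L, τ ∈ S v} := by
    intro τ hτ
    simp only [noRun, Set.mem_compl_iff, Set.mem_ofPred_eq] at hτ
    push Not at hτ
    obtain ⟨v, hv, h⟩ := hτ
    refine ⟨v, by simp; omega, hv, fun x hx1 hx2 => ?_⟩
    simpa using h x hx1 hx2
  refine (pr_mono h0 h1 hsub).trans ((pr_biUnion_le h0 h1 _ S).trans ?_)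
  have : ∀ v ∈ Finset.range L, pr p (S v) ≤ (1 - p) ^ r := by
    intro v _
    by_cases hv : v + r < L
    · let e : Fin r × Unit → Fin L := fun d => ⟨v + d.1, by have := d.1.2; omega⟩
      have he : Function.Injective e := by
        rintro ⟨a, _⟩ ⟨b, _⟩ h
        simp only [e, Fin.mk.injEq] at h
        ext
        simpa using h
      have h2 := pr_block_embed p e he {τ | τ () = false}
      have h3 : pr p {τ : Unit → Bool | τ () = false} = 1 - p := by
        rw [pr_eq]
        unfold expec
        rw [Fintype.sum_equiv (Equiv.funUnique Unit Bool) _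
          (fun b => (if b then 0 else 1) * (if b then p else 1 - p))]
        · simp
        · intro τ
          cases h : τ () <;> simp [h]
      rw [h3, Fintype.card_fin] at h2
      rw [← h2]
      refine pr_mono h0 h1 ?_
      intro τ hτ i
      exact hτ.2 _ (by simp [e]) (by simp [e])
    · have : S v = ∅ := by ext τ; simp [S, hv]
      rw [this]
      have : (0:ℝ) ≤ (1 - p) ^ r := pow_nonneg (by linarith) _
      simpa [pr] using this
  refine (Finset.sum_le_sum this).trans ?_
  simp

/-- good blocks -/
def goodSet (T K j r : ℕ) : Set (Fin (T * (K * (2 * j))) → Bool) :=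
  hasSeed T K j ∩ noRun (T * (K * (2 * j))) r

lemma bad_pr {p : ℝ} (h0 : 0 < p) (h1 : p < 1) {j K r : ℕ}
    (hq : 0 < pr p (cellSet j)) (hKr : j * K ≤ r + j)
    (hK : 22 * 64 * (j:ℝ) * K * ((1 - p) ^ j) ^ K ≤ (1 - p) ^ j * (pr p (cellSet j)) ^ K) :
    ∃ T : ℕ, 10 ≤ T ∧ pr p (goodSet T K j r)ᶜ ≤ 1 / 32 := by
  set q := pr p (cellSet j)
  have hq1 : q ≤ 1 := pr_le_one h0.le h1.le _
  set s := q ^ K with hs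
  have hs0 : 0 < s := pow_pos hq K
  have hs1 : s ≤ 1 := pow_le_one₀ hq.le hq1
  refine ⟨⌈10 / s⌉₊, ?_, ?_⟩
  · have : (10:ℝ) ≤ ⌈10 / s⌉₊ := by
      refine le_trans ?_ (Nat.le_ceil _)
      rw [le_div_iff₀ hs0]; linarith
    exact_mod_cast this
  set T := ⌈10 / s⌉₊ with hT
  have hT1 : 10 ≤ T * s := by
    have := Nat.le_ceil (10 / s)
    rwa [div_le_iff₀ hs0] at this
  have hT2 : T * s ≤ 11 := by
    have := (Nat.ceil_lt_add_one (a := 10 / s) (by positivity)).le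
    have h2 := mul_le_mul_of_nonneg_right this hs0.le
    rw [add_mul, div_mul_cancel₀ _ hs0.ne'] at h2
    linarith
  have hA : pr p (hasSeed T K j)ᶜ ≤ 1 / 64 := by
    rw [seed_pr]
    have h2 : (1 - s) ^ T ≤ Real.exp (-10) := by
      have h3 : 1 - s ≤ Real.exp (-s) := by have := Real.add_one_le_exp (-s); linarith
      calc (1 - s) ^ T ≤ (Real.exp (-s)) ^ T := pow_le_pow_left₀ (by linarith) h3 T
        _ = Real.exp (-(T * s)) := by rw [← Real.exp_nat_mul]; ring_nf
        _ ≤ Real.exp (-10) := Real.exp_le_exp.mpr (by linarith)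
    refine h2.trans ?_
    rw [Real.exp_neg, one_div]
    apply inv_anti₀ (by norm_num)
    have h5 : (2:ℝ) ≤ Real.exp 1 := by have := Real.add_one_le_exp (1:ℝ); linarith
    have : Real.exp 10 = (Real.exp 1) ^ 10 := by rw [← Real.exp_nat_mul]; norm_num
    rw [this]
    calc (64:ℝ) ≤ 2 ^ 10 := by norm_num
      _ ≤ _ := pow_le_pow_left₀ (by norm_num) h5 10
  have hB : pr p (noRun (T * (K * (2 * j))) r)ᶜ ≤ 1 / 64 := by
    refine (run_pr h0.le h1.le _ r).trans ?_
    push_cast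
    have hb : 0 < (1 - p) ^ j := pow_pos (by linarith) _
    have hr : (1 - p) ^ r * (1 - p) ^ j ≤ ((1 - p) ^ j) ^ K := by
      rw [← pow_add, ← pow_mul]
      exact pow_le_pow_of_le_one (by linarith) (by linarith) hKr
    set b := (1 - p) ^ j
    set x := (1 - p) ^ r
    have hx : 0 < x := pow_pos (by linarith) _
    have hjK : (0:ℝ) ≤ 22 * 64 * j * K := by positivity
    have h3 : 22 * 64 * (j:ℝ) * K * (x * b) ≤ b * s :=
      (mul_le_mul_of_nonneg_left hr hjK).trans hK
    have h4 : 22 * 64 * (j:ℝ) * K * x ≤ s := by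
      have : b * (22 * 64 * (j:ℝ) * K * x) ≤ b * s := by linarith
      exact le_of_mul_le_mul_left this hb
    have h5 : (T:ℝ) * (22 * 64 * (j:ℝ) * K * x) ≤ 11 :=
      (mul_le_mul_of_nonneg_left h4 (by positivity)).trans hT2
    nlinarith
  have : (goodSet T K j r)ᶜ = (hasSeed T K j)ᶜ ∪ (noRun (T * (K * (2 * j))) r)ᶜ := by
    rw [goodSet, Set.compl_inter]
  rw [this]
  refine (pr_union_le h0.le h1.le _ _).trans ?_
  linarith

/-- position of the blocks in the ring -/
def emb (n M L : ℕ) : Fin M × Fin L → ZMod n := fun x => ((x.1 * L + x.2 : ℕ) : ZMod n)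

lemma emb_inj {n M L : ℕ} (h : M * L ≤ n) : Function.Injective (emb n M L) := by
  rintro ⟨a, x⟩ ⟨b, y⟩ hxy
  simp only [emb] at hxy
  have lt : ∀ (c : Fin M) (z : Fin L), (c:ℕ) * L + z < n := by
    intro c z
    have h1 : ((c:ℕ) + 1) * L ≤ M * L := Nat.mul_le_mul_right L c.2
    have := z.2
    rw [add_mul] at h1
    omega
  rw [ZMod.natCast_eq_natCast_iff', Nat.mod_eq_of_lt (lt a x), Nat.mod_eq_of_lt (lt b y)] at hxy
  have hL : 0 < L := lt_of_le_of_lt (Nat.zero_le _) x.2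
  have e : ∀ (c : Fin M) (z : Fin L), ((c:ℕ) * L + z) / L = c := by
    intro c z
    rw [mul_comm, Nat.mul_add_div hL, Nat.div_eq_of_lt z.2, add_zero]
  have hab : (a:ℕ) = b := by rw [← e a x, ← e b y, hxy]
  have hxy' : (x:ℕ) = y := by rw [hab] at hxy; omega
  ext
  · exact hab
  · exact hxy'

lemma good_active {n r M T K j : ℕ} [NeZero n] (hj : 0 < j) (hK1 : r < j * K)
    (hr : 100 * j ^ 2 ≤ r) (σ : ZMod n → Bool) (m : Fin M)
    (hg : (fun x => σ (emb n M (T * (K * (2 * j))) (m, x))) ∈ goodSet T K j r)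
    (x : Fin (T * (K * (2 * j)))) (hx1 : r ≤ x) (hx2 : (x:ℕ) + r < T * (K * (2 * j))) :
    ringFix n r σ (emb n M _ (m, x)) = true := by
  obtain ⟨⟨t, ht⟩, hrun⟩ := hg
  have hf := ringFix_closed n r σ
  have hact : ∀ y : Fin (T * (K * (2 * j))), σ (emb n M (T * (K * (2 * j))) (m, y)) = true →
      (fun k : ℤ => ringFix n r σ (k : ZMod n)) ((m:ℤ) * (T * (K * (2 * j)) : ℕ) + y) = true := by
    intro y hy
    have := le_iter n r σ n _ hy
    simpa [emb, ringFix] using this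
  have main := block_full hf (lo := (m:ℤ) * (T * (K * (2 * j)) : ℕ)) (hi := (m:ℤ) * (T * (K * (2 * j)) : ℕ) + (T * (K * (2 * j)) : ℕ))
    (s := (m:ℤ) * (T * (K * (2 * j)) : ℕ) + t * (K * (2 * j) : ℕ)) (j := j) (K := K) hj ?_ ?_ ?_ ?_ hK1 hr
    ((m:ℤ) * (T * (K * (2 * j)) : ℕ) + x) (by omega) (by omega)
  · simpa [emb] using main
  · intro v hv1 hv2
    obtain ⟨y, hy1, hy2, hy⟩ := hrun (v - m * (T * (K * (2 * j)) : ℕ)).toNat (by omega)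
    exact ⟨m * (T * (K * (2 * j)) : ℕ) + y, by omega, by omega, hact y hy⟩
  · have : (0:ℤ) ≤ t * (K * (2 * j) : ℕ) := by positivity
    omega
  · have h1 : ((t:ℕ) + 1) * (K * (2 * j)) ≤ (T * (K * (2 * j))) := Nat.mul_le_mul_right _ t.2
    have h2 : (((t:ℕ) + 1) * (K * (2 * j) : ℕ) : ℤ) ≤ (T * (K * (2 * j)) : ℕ) := by exact_mod_cast h1
    push_cast at h2 ⊢
    linarith
  · intro i hi
    have hcell := ht ⟨i, hi⟩
    simp only [cellSet, Set.mem_ofPred_eq] at hcell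
    refine hcell.trans ?_
    unfold cnt
    refine Finset.card_le_card_of_injOn
      (fun y => (m:ℤ) * (T * (K * (2 * j)) : ℕ) + t * (K * (2 * j) : ℕ) + 2 * j * i + (y : ℕ)) ?_ ?_
    · intro y hy
      simp only [Finset.coe_filter, Finset.mem_univ, true_and, Set.mem_ofPred_eq] at hy
      have := hact _ hy
      have hy2 := y.2
      simp only [Finset.coe_filter, Set.mem_ofPred_eq, Finset.mem_Ico]
      refine ⟨⟨by omega, by omega⟩, ?_⟩
      convert this using 3
      simp only [finProdFinEquiv_apply_val]
      push_cast
      ring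
    · intro a _ b _ hab
      simp only [add_right_inj, Nat.cast_inj] at hab
      exact Fin.ext hab

open Classical in
lemma active_count {n r M T K j : ℕ} [NeZero n] (hj : 0 < j) (hK1 : r < j * K)
    (hr : 100 * j ^ 2 ≤ r) (σ : ZMod n → Bool) (hM : M * (T * (K * (2 * j))) ≤ n) :
    (Finset.univ.filter (fun m : Fin M =>
      (fun x => σ (emb n M (T * (K * (2 * j))) (m, x))) ∈ goodSet T K j r)).card *
      (T * (K * (2 * j)) - 2 * r) ≤
    (Finset.univ.filter (fun i : ZMod n => ringFix n r σ i = true)).card := by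
  set L := T * (K * (2 * j)) with hL
  set G := Finset.univ.filter (fun m : Fin M =>
      (fun x => σ (emb n M L (m, x))) ∈ goodSet T K j r)
  set X := Finset.univ.filter (fun x : Fin L => r ≤ x ∧ (x:ℕ) + r < L)
  have hX : L - 2 * r ≤ X.card := by
    have : (Finset.Ico r (L - r)).card ≤ X.card := by
      refine Finset.card_le_card_of_surjOn (fun x : Fin L => (x : ℕ)) ?_
      intro y hy
      simp only [Finset.coe_Ico, Set.mem_Ico] at hy
      exact ⟨⟨y, by omega⟩, by simp [X]; omega, rfl⟩
    rw [Nat.card_Ico] at this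
    omega
  calc G.card * (L - 2 * r) ≤ G.card * X.card := Nat.mul_le_mul_left _ hX
    _ = (G ×ˢ X).card := (Finset.card_product _ _).symm
    _ ≤ _ := by
      refine Finset.card_le_card_of_injOn (emb n M L) ?_ ((emb_inj hM).injOn)
      rintro ⟨m, x⟩ hmx
      simp only [Finset.coe_product, Set.mem_prod, Finset.mem_coe] at hmx
      obtain ⟨h1, h2⟩ := hmx
      simp only [G, X, Finset.mem_filter, Finset.mem_univ, true_and] at h1 h2
      simp only [Finset.coe_filter, Finset.mem_univ, true_and, Set.mem_ofPred_eq]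
      exact good_active hj hK1 hr σ m h1 x h2.1 h2.2

open Classical in
lemma chernoff {p : ℝ} (h0 : 0 ≤ p) (h1 : p ≤ 1) {n M L : ℕ} [NeZero n] (hM : M * L ≤ n)
    (G : Set (Fin L → Bool)) (hG : pr p Gᶜ ≤ 1 / 32) :
    pr p {σ : ZMod n → Bool |
      M ≤ 4 * (Finset.univ.filter (fun m : Fin M => (fun x => σ (emb n M L (m, x))) ∉ G)).card} ≤
      (47 / 64) ^ M := by
  set g : (Fin L → Bool) → ℝ := fun τ => if τ ∈ G then 1 else 16 with hg
  have hge : expec p g ≤ 47 / 32 := by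
    have : g = fun τ => 1 + 15 * (Gᶜ).indicator 1 τ := by
      funext τ
      by_cases h : τ ∈ G <;> simp [hg, h]
      norm_num
    rw [this, expec_add, expec_one, expec_const_mul, ← pr_eq]
    linarith
  have hg0 : 0 ≤ expec p g := by
    have := expec_mono h0 h1 (F := fun _ => 0) (G := g)
      (fun τ => by simp only [hg]; split_ifs <;> norm_num)
    simpa [expec] using this
  have hE := expec_block_embed p (emb n M L) (emb_inj hM) g
  rw [Fintype.card_fin] at hE
  have hmarkov : (2:ℝ) ^ M * pr p {σ : ZMod n → Bool |
      M ≤ 4 * (Finset.univ.filter (fun m : Fin M => (fun x => σ (emb n M L (m, x))) ∉ G)).card} ≤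
      (expec p g) ^ M := by
    rw [← hE, pr_eq, ← expec_const_mul]
    refine expec_mono h0 h1 fun σ => ?_
    have hprod : ∏ i : Fin M, g (fun k => σ (emb n M L (i, k))) =
        16 ^ (Finset.univ.filter
          (fun m : Fin M => (fun x => σ (emb n M L (m, x))) ∉ G)).card := by
      simp only [hg]
      rw [Finset.prod_ite]
      simp
    rw [hprod, Set.indicator_apply]
    split_ifs with h
    · simp only [Set.mem_ofPred_eq] at h
      rw [Pi.one_apply, mul_one, show (16:ℝ) = 2 ^ 4 by norm_num, ← pow_mul]
      exact pow_le_pow_right₀ (by norm_num) h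
    · rw [mul_zero]; positivity
  have h3 : (expec p g) ^ M ≤ (47 / 32) ^ M := pow_le_pow_left₀ hg0 hge M
  have h4 : (47 / 64 : ℝ) ^ M = (47 / 32) ^ M / 2 ^ M := by rw [← div_pow]; norm_num
  rw [h4, le_div_iff₀ (by positivity)]
  linarith

lemma pR_lower {p : ℝ} (h0 : 0 < p) (h1 : p < 1) {r T K j n : ℕ} (hn : n ≠ 0) (hj : 0 < j)
    (hK1 : r < j * K) (hr : 100 * j ^ 2 ≤ r) (hT : 10 ≤ T)
    (hbad : pr p (goodSet T K j r)ᶜ ≤ 1 / 32) (hM : 3 ≤ n / (T * (K * (2 * j)))) :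
    1 - (47 / 64 : ℝ) ^ (n / (T * (K * (2 * j)))) ≤ pR r p n := by
  classical
  have : NeZero n := ⟨hn⟩
  rw [pR, dif_neg hn]
  have hML : n / (T * (K * (2 * j))) * (T * (K * (2 * j))) ≤ n := Nat.div_mul_le_self _ _
  have hch := chernoff h0.le h1.le hML _ hbad
  set L := T * (K * (2 * j)) with hL
  set M := n / L
  have hL20 : 20 * r ≤ L := by
    have : 10 * (K * (2 * j)) ≤ L := Nat.mul_le_mul_right _ hT
    have e : K * (2 * j) = 2 * (j * K) := by ring
    omega
  have hLpos : 0 < L := by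
    rcases Nat.eq_zero_or_pos L with h | h
    · have : M = 0 := by simp [M, h]
      omega
    · exact h
  have hnlt : n < (M + 1) * L := by
    have := Nat.div_add_mod n L
    have h2 := Nat.mod_lt n hLpos
    have e : (M + 1) * L = L * (n / L) + L := by simp only [M]; ring
    omega
  refine le_trans (sub_le_sub_left hch 1) ?_
  rw [← pr_compl]
  refine pr_mono h0.le h1.le ?_
  intro σ hσ
  simp only [Set.mem_compl_iff, Set.mem_ofPred_eq, not_le] at hσ ⊢
  have hact := active_count hj hK1 hr σ hML
  have hsum := Finset.card_filter_add_card_filter_not (s := (Finset.univ : Finset (Fin M)))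
    (fun m : Fin M => (fun x => σ (emb n M L (m, x))) ∈ goodSet T K j r)
  rw [Finset.card_univ, Fintype.card_fin] at hsum
  set g := (Finset.univ.filter (fun m : Fin M =>
      (fun x => σ (emb n M L (m, x))) ∈ goodSet T K j r)).card
  set b := (Finset.univ.filter (fun m : Fin M =>
      (fun x => σ (emb n M L (m, x))) ∉ goodSet T K j r)).card
  have h3 : 3 * M ≤ 4 * g := by omega
  have h4 : 9 * L ≤ 10 * (L - 2 * r) := by omega
  have h5 : (3 * M) * (9 * L) ≤ (4 * g) * (10 * (L - 2 * r)) := Nat.mul_le_mul h3 h4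
  have h6 : 3 * L ≤ M * L := Nat.mul_le_mul_right L hM
  refine lt_of_lt_of_le ?_ (Nat.mul_le_mul_left 2 (show g * (L - 2 * r) ≤ _ from hact))
  nlinarith

/-- If `1 > p > 1/4` then there is `r_0 = r_0(p)` such that for all `r ≥ r_0`,
`lim_{n→∞} p_R(n,r,p) = 1`. -/
theorem pR_tendsto_one (p : ℝ) (hp : 1 / 4 < p) (hp1 : p < 1) :
    ∃ r0 : ℕ, 0 < r0 ∧ ∀ r : ℕ, r0 ≤ r →
      Filter.Tendsto (fun n => pR r p n) Filter.atTop (nhds 1) := by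
  have h0 : 0 < p := by linarith
  obtain ⟨j, hj, hjq⟩ := exists_j hp hp1
  have ha : 0 < (1 - p) ^ j := pow_pos (by linarith) _
  have hj' : (0:ℝ) < j := by exact_mod_cast hj
  obtain ⟨K0, hK0⟩ := exists_K (C := 22 * 64 * j) ha.le hjq ha (by positivity)
  refine ⟨100 * j ^ 2 + j * K0, by positivity, fun r hr => ?_⟩
  have hr1 : 100 * j ^ 2 ≤ r := by omega
  have hd := Nat.div_add_mod r j
  have hm := Nat.mod_lt r hj
  have hK1 : r < j * (r / j + 1) := by rw [mul_add]; omega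
  have hK2 : j * (r / j + 1) ≤ r + j := by rw [mul_add]; omega
  have hK3 : K0 ≤ r / j + 1 := by
    have : j * K0 < j * (r / j + 1) := by omega
    exact (Nat.lt_of_mul_lt_mul_left this).le
  obtain ⟨T, hT, hbad⟩ := bad_pr h0 hp1 (ha.trans hjq) hK2 (hK0 _ hK3)
  set K := r / j + 1
  have hL : 0 < T * (K * (2 * j)) := by positivity
  have hdiv : Filter.Tendsto (fun n : ℕ => n / (T * (K * (2 * j)))) Filter.atTop Filter.atTop :=
    Nat.tendsto_div_const_atTop hL.ne'
  have hlow : Filter.Tendsto (fun n : ℕ => 1 - (47 / 64 : ℝ) ^ (n / (T * (K * (2 * j)))))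
      Filter.atTop (nhds 1) := by
    have h := (tendsto_pow_atTop_nhds_zero_of_lt_one (r := (47 / 64 : ℝ)) (by norm_num)
      (by norm_num)).comp hdiv
    simpa using h.const_sub 1
  refine tendsto_of_tendsto_of_tendsto_of_le_of_le' hlow tendsto_const_nhds ?_ ?_
  · filter_upwards [hdiv.eventually_ge_atTop 3, Filter.eventually_gt_atTop 0] with n hn hn0
    exact pR_lower h0 hp1 hn0.ne' hj hK1 hr1 hT hbad hn
  · filter_upwards [Filter.eventually_gt_atTop 0] with n hn0
    rw [pR, dif_neg hn0.ne']
    have : NeZero n := ⟨hn0.ne'⟩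
    exact pr_le_one h0.le hp1.le _
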